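/- Let φ1, φ2 be LTL_f formulas, let T0 ≤ t0 ≤ i ≤ t' be times, and fix label sets L_{T0}, …, L_{t'} ⊆ P. (i) If every continuation ρ^{t0…t⁺} of the partial trace ρ^{t0…t'} = (L_{t0}, …, L_{t'}) satisfies ρ^{t0…t⁺} ⊭ φ2, then every continuation satisfies ρ^{t0…t⁺} ⊭ φ1 M φ2. (ii) If every continuation ρ^{i…t⁺} of the partial trace ρ^{i…t'} = (L_i, …, L_{t'}) satisfies ρ^{i…t⁺} ⊨ φ1, and for every k with t0 ≤ k ≤ i every continuation ρ^{k…t⁺} of the partial trace ρ^{k…t'} = (L_k, …, L_{t'}) satisfies ρ^{k…t⁺} ⊨ φ2, then every continuation ρ^{t0…t⁺} of ρ^{t0…t'} satisfies ρ^{t0…t⁺} ⊨ φ1 M φ2. (Correctness of the Strong Release module of the LPT algorithm.) -/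

import Mathlib

/-- Finite-trace LTL (LTL_f) formulas over atomic propositions `P`:
`true`, atoms, conjunction, negation, Next, Until. -/
inductive LTLf (P : Type) : Type where
  | tt    : LTLf P
  | atom  : P → LTLf P
  | conj  : LTLf P → LTLf P → LTLf P
  | neg   : LTLf P → LTLf P
  | next  : LTLf P → LTLf P
  | untl  : LTLf P → LTLf P → LTLf P

/-- Satisfaction of an LTL_f formula on the suffix starting at time `t` of a finite
trace with labels `L` and final time `Tf`. -/
def Sat {P : Type} (L : ℕ → Set P) (Tf : ℕ) : LTLf P → ℕ → Prop
  | .tt, _ => True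
  | .atom a, t => a ∈ L t
  | .conj φ ψ, t => Sat L Tf φ t ∧ Sat L Tf ψ t
  | .neg φ, t => ¬ Sat L Tf φ t
  | .next φ, t => t < Tf ∧ Sat L Tf φ (t + 1)
  | .untl φ ψ, t => ∃ i, t ≤ i ∧ i ≤ Tf ∧ Sat L Tf ψ i ∧ ∀ k, t ≤ k → k < i → Sat L Tf φ k

/-- Derived disjunction: φ1 ∨ φ2 := ¬(¬φ1 ∧ ¬φ2). -/
def LTLf.disj {P : Type} (φ ψ : LTLf P) : LTLf P := .neg (.conj (.neg φ) (.neg ψ))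

/-- Derived implication: φ1 → φ2 := ¬φ1 ∨ φ2. -/
def LTLf.impl {P : Type} (φ ψ : LTLf P) : LTLf P := LTLf.disj (.neg φ) ψ

/-- Derived Eventually: F φ := true U φ. -/
def LTLf.ev {P : Type} (φ : LTLf P) : LTLf P := .untl .tt φ

/-- Derived Global: G φ := ¬F¬φ. -/
def LTLf.glob {P : Type} (φ : LTLf P) : LTLf P := .neg (LTLf.ev (.neg φ))

/-- Derived Weak Until: φ1 W φ2 := (φ1 U φ2) ∨ G φ1. -/
def LTLf.wuntl {P : Type} (φ ψ : LTLf P) : LTLf P := LTLf.disj (.untl φ ψ) (LTLf.glob φ)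

/-- Derived Strong Release: φ1 M φ2 := φ2 U (φ1 ∧ φ2). -/
def LTLf.srel {P : Type} (φ ψ : LTLf P) : LTLf P := .untl ψ (.conj φ ψ)

/-- Derived Release: φ1 R φ2 := ¬(¬φ1 U ¬φ2). -/
def LTLf.rel {P : Type} (φ ψ : LTLf P) : LTLf P := .neg (.untl (.neg φ) (.neg ψ))

/-- Correctness of the Strong Release module of the LPT algorithm. -/
theorem strong_release_module_correct {P : Type} (φ1 φ2 : LTLf P) (T0 t0 i t' : ℕ)
    (hT0 : T0 ≤ t0) (ht0i : t0 ≤ i) (hit' : i ≤ t') (L : ℕ → Set P) :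
    ((∀ (L' : ℕ → Set P) (tp : ℕ), t' ≤ tp →
        (∀ s, t0 ≤ s → s ≤ t' → L' s = L s) → ¬ Sat L' tp φ2 t0) →
      ∀ (L' : ℕ → Set P) (tp : ℕ), t' ≤ tp →
        (∀ s, t0 ≤ s → s ≤ t' → L' s = L s) → ¬ Sat L' tp (LTLf.srel φ1 φ2) t0) ∧
    (((∀ (L' : ℕ → Set P) (tp : ℕ), t' ≤ tp →
          (∀ s, i ≤ s → s ≤ t' → L' s = L s) → Sat L' tp φ1 i) ∧
      (∀ k, t0 ≤ k → k ≤ i →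
        ∀ (L' : ℕ → Set P) (tp : ℕ), t' ≤ tp →
          (∀ s, k ≤ s → s ≤ t' → L' s = L s) → Sat L' tp φ2 k)) →
      ∀ (L' : ℕ → Set P) (tp : ℕ), t' ≤ tp →
        (∀ s, t0 ≤ s → s ≤ t' → L' s = L s) → Sat L' tp (LTLf.srel φ1 φ2) t0) := by
  refine ⟨fun h L' tp htp hL => ?_, fun ⟨h1, h2⟩ L' tp htp hL => ?_⟩
  · rintro ⟨j, hj, -, ⟨-, h2⟩, hk⟩
    rcases hj.eq_or_lt with rfl | hlt
    · exact h L' tp htp hL h2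
    · exact h L' tp htp hL (hk t0 le_rfl hlt)
  · have sat2 : ∀ k, t0 ≤ k → k ≤ i → Sat L' tp φ2 k := fun k hk hki =>
      h2 k hk hki L' tp htp fun s hs => hL s (hk.trans hs)
    exact ⟨i, ht0i, hit'.trans htp,
      ⟨h1 L' tp htp fun s hs => hL s (ht0i.trans hs), sat2 i ht0i le_rfl⟩,
      fun k hk hki => sat2 k hk hki.le⟩
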